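/- Let x ∈ Δ. If x ∈ ∂Δ or ω(x) ⊂ Δ̊, then ω(x) ⊂ R_ap. Consequently, for every x ∈ Δ, ω(x) ∩ R_ap ≠ ∅. -/

import Mathlib

open Metric Set Filter Topology
open scoped Classical ENNReal

noncomputable section

abbrev Euc (d : ℕ) := EuclideanSpace ℝ (Fin d)

/-- The standard simplex `Δ`. -/
def simplexSet (d : ℕ) : Set (Euc d) := {x | (∀ i, 0 ≤ x i) ∧ ∑ i, x i = 1}

/-- The relative interior `Δ̊`. -/
def simplexInt (d : ℕ) : Set (Euc d) := {x | (∀ i, 0 < x i) ∧ ∑ i, x i = 1}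

/-- The relative boundary `∂Δ`. -/
def simplexBd (d : ℕ) : Set (Euc d) := simplexSet d \ simplexInt d

/-- `Δ_N = Δ ∩ (1/N)ℤ^d`. -/
def deltaN (d N : ℕ) : Set (Euc d) := simplexSet d ∩ {x | ∀ i, ∃ z : ℤ, x i = (z : ℝ) / N}

/-- `Δ*_N = Δ̊ ∩ (1/N)ℤ^d`. -/
def deltaNstar (d N : ℕ) : Set (Euc d) := simplexInt d ∩ {x | ∀ i, ∃ z : ℤ, x i = (z : ℝ) / N}

/-- `F` is locally Lipschitz on `Δ` and its coordinates sum to zero. -/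
def IsMeanField (d : ℕ) (F : Euc d → Euc d) : Prop :=
  (∀ x ∈ simplexSet d, ∃ (K : NNReal) (ε : ℝ), 0 < ε ∧
      LipschitzOnWith K F (Metric.ball x ε ∩ simplexSet d)) ∧
  ∀ x ∈ simplexSet d, ∑ i, F x i = 0

/-- `φ` is the flow induced by the ODE `ẋ = F(x)`, leaving `Δ` and `∂Δ` invariant. -/
structure IsFlowOf (d : ℕ) (F : Euc d → Euc d) (φ : ℝ → Euc d → Euc d) : Prop where
  cont : Continuous fun p : ℝ × Euc d => φ p.1 p.2
  map_zero : ∀ x, φ 0 x = x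
  map_add : ∀ s t x, φ (s + t) x = φ s (φ t x)
  deriv : ∀ x ∈ simplexSet d, ∀ t : ℝ, HasDerivAt (fun s => φ s x) (F (φ t x)) t
  inv : ∀ t : ℝ, ∀ x ∈ simplexSet d, φ t x ∈ simplexSet d
  bdInv : ∀ t : ℝ, ∀ x ∈ simplexBd d, φ t x ∈ simplexBd d

/-- The data `(k, xs, ts)` is a `(δ,T)` absorption-preserving pseudo-orbit:
points `xs 0, …, xs (k+1)` of `Δ` and times `ts 1, …, ts k ≥ T`. -/
def IsAPOrbit (d : ℕ) (φ : ℝ → Euc d → Euc d) (δ T : ℝ) (k : ℕ)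
    (xs : ℕ → Euc d) (ts : ℕ → ℝ) : Prop :=
  1 ≤ k ∧ (∀ j ≤ k + 1, xs j ∈ simplexSet d) ∧ dist (xs 0) (xs 1) < δ ∧
  (∀ j, 1 ≤ j → j ≤ k → T ≤ ts j ∧ dist (φ (ts j) (xs j)) (xs (j + 1)) < δ) ∧
  (∀ j ≤ k, xs j ∈ simplexBd d → xs (j + 1) ∈ simplexBd d)

/-- `x ⇝_ap y`. -/
def leadsAp (d : ℕ) (φ : ℝ → Euc d → Euc d) (x y : Euc d) : Prop :=
  ∀ δ > (0 : ℝ), ∀ T > (0 : ℝ), ∃ k xs ts,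
    IsAPOrbit d φ δ T k xs ts ∧ xs 0 = x ∧ xs (k + 1) = y

/-- The set `R_ap` of ap-chain-recurrent points. -/
def Rap (d : ℕ) (φ : ℝ → Euc d → Euc d) : Set (Euc d) := {x | leadsAp d φ x x}

/-- The ap-basic class `[x]_ap`. -/
def apClass (d : ℕ) (φ : ℝ → Euc d → Euc d) (x : Euc d) : Set (Euc d) :=
  {y | leadsAp d φ x y ∧ leadsAp d φ y x}

/-- The class of `x` is maximal for the order `≺`, i.e. is an ap-quasi-attractor. -/
def IsAPQuasiAttractorAt (d : ℕ) (φ : ℝ → Euc d → Euc d) (x : Euc d) : Prop :=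
  x ∈ Rap d φ ∧ ∀ y ∈ Rap d φ, leadsAp d φ x y → leadsAp d φ y x

/-- The omega-limit set of `x` under the flow `φ`. -/
def omegaSet (d : ℕ) (φ : ℝ → Euc d → Euc d) (x : Euc d) : Set (Euc d) :=
  {y | ∃ u : ℕ → ℝ, Tendsto u atTop atTop ∧ Tendsto (fun n => φ (u n) x) atTop (nhds y)}

/-- `A` is an attractor for the flow `φ`: compact, invariant, attracting a
neighborhood uniformly. -/
def IsAttractor (d : ℕ) (φ : ℝ → Euc d → Euc d) (A : Set (Euc d)) : Prop :=
  IsCompact A ∧ (∀ t : ℝ, φ t '' A = A) ∧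
  ∃ U : Set (Euc d), IsOpen U ∧ A ⊆ U ∧
    ∀ ε > (0 : ℝ), ∃ T : ℝ, ∀ t ≥ T, ∀ x ∈ U, infDist (φ t x) A < ε


theorem mem_omega_iff {d : ℕ} (φ : ℝ → Euc d → Euc d) (x y : Euc d) :
    y ∈ omegaSet d φ x ↔ ∀ ε > (0:ℝ), ∀ T : ℝ, ∃ t ≥ T, dist (φ t x) y < ε := by
  constructor
  · rintro ⟨u, hu, hy⟩ ε hε T
    have h1 := hu.eventually_ge_atTop T
    have h2 := (Metric.tendsto_nhds.1 hy) ε hε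
    obtain ⟨n, hn1, hn2⟩ := (h1.and h2).exists
    exact ⟨u n, hn1, hn2⟩
  · intro h
    choose u hu1 hu2 using fun n : ℕ => h (1 / ((n:ℝ) + 1)) (by positivity) n
    refine ⟨u, tendsto_atTop_mono hu1 tendsto_natCast_atTop_atTop, ?_⟩
    rw [tendsto_iff_dist_tendsto_zero]
    exact squeeze_zero (fun _ => dist_nonneg) (fun n => (hu2 n).le)
      tendsto_one_div_add_atTop_nhds_zero_nat

theorem simplex_closed (d : ℕ) : IsClosed (simplexSet d) := by
  have h : simplexSet d = (⋂ i, {x : Euc d | 0 ≤ x i}) ∩ {x | ∑ i, x i = 1} := by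
    ext x; simp [simplexSet]
  rw [h]
  refine (isClosed_iInter fun i => isClosed_le continuous_const (by fun_prop)).inter
    (isClosed_eq (by fun_prop) continuous_const)

theorem bd_closed (d : ℕ) : IsClosed (simplexBd d) := by
  have h : simplexBd d = simplexSet d ∩ (⋃ i, {x : Euc d | x i ≤ 0}) := by
    ext x
    simp only [simplexBd, simplexSet, simplexInt, mem_diff, mem_setOf_eq, mem_inter_iff,
      mem_iUnion]
    constructor
    · rintro ⟨h1, h2⟩
      refine ⟨h1, ?_⟩
      by_contra! hc
      exact h2 ⟨hc, h1.2⟩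
    · rintro ⟨h1, i, hi⟩
      exact ⟨h1, fun h => absurd (h.1 i) (not_lt.2 hi)⟩
  rw [h]
  exact (simplex_closed d).inter
    (isClosed_iUnion_of_finite fun i => isClosed_le (by fun_prop) continuous_const)

theorem simplex_compact (d : ℕ) : IsCompact (simplexSet d) := by
  refine Metric.isCompact_of_isClosed_isBounded (simplex_closed d) ?_
  refine (Metric.isBounded_closedBall (x := (0 : Euc d)) (r := Real.sqrt d)).subset ?_
  intro x hx
  rw [mem_closedBall_zero_iff, EuclideanSpace.norm_eq]
  apply Real.sqrt_le_sqrt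
  have : ∀ i ∈ Finset.univ, ‖x i‖ ^ 2 ≤ (1:ℝ) := by
    intro i hi
    have h1 : x i ≤ 1 := by
      rw [← hx.2]
      exact Finset.single_le_sum (f := fun i => x i) (fun j _ => hx.1 j) hi
    have h0 := hx.1 i
    rw [Real.norm_eq_abs, sq_abs]
    nlinarith
  calc _ ≤ ∑ i : Fin d, (1:ℝ) := Finset.sum_le_sum this
    _ = d := by simp

theorem omega_nonempty {d : ℕ} {F : Euc d → Euc d} {φ : ℝ → Euc d → Euc d}
    (hφ : IsFlowOf d F φ) {x : Euc d} (hx : x ∈ simplexSet d) :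
    (omegaSet d φ x).Nonempty := by
  obtain ⟨y, -, s, hs, hy⟩ := (simplex_compact d).tendsto_subseq
    (x := fun n : ℕ => φ n x) (fun n => hφ.inv n x hx)
  exact ⟨y, fun n => (s n : ℝ), tendsto_natCast_atTop_atTop.comp hs.tendsto_atTop, hy⟩

theorem omega_closed_sub {d : ℕ} {φ : ℝ → Euc d → Euc d} {x y : Euc d} {S : Set (Euc d)}
    (hS : IsClosed S) (h : ∀ t, φ t x ∈ S) (hy : y ∈ omegaSet d φ x) : y ∈ S := by
  obtain ⟨u, -, hu⟩ := hy
  exact hS.mem_of_tendsto hu (Eventually.of_forall fun n => h _)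

theorem omega_rap {d : ℕ} {F : Euc d → Euc d} {φ : ℝ → Euc d → Euc d}
    (hφ : IsFlowOf d F φ) {x y : Euc d} (hx : x ∈ simplexSet d)
    (hy : y ∈ omegaSet d φ x) (hb : y ∈ simplexBd d → x ∈ simplexBd d) : y ∈ Rap d φ := by
  intro δ hδ T hT
  have hyS := omega_closed_sub (simplex_closed d) (fun t => hφ.inv t x hx) hy
  have h := (mem_omega_iff φ x y).1 hy
  obtain ⟨s, -, hs⟩ := h δ hδ 0
  obtain ⟨t, ht, ht'⟩ := h δ hδ (s + T)
  refine ⟨1, fun n => if n = 1 then φ s x else y, fun _ => t - s,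
    ⟨le_rfl, ?_, ?_, ?_, ?_⟩, by simp, by simp⟩
  · intro j _
    dsimp only
    split_ifs
    exacts [hφ.inv s x hx, hyS]
  · simpa [dist_comm] using hs
  · intro j h1 h2
    obtain rfl : j = 1 := le_antisymm h2 h1
    refine ⟨by linarith, ?_⟩
    simp only [if_true]
    rw [← hφ.map_add]
    simpa using ht'
  · intro j hj hjb
    interval_cases j
    · simp only [zero_add, if_true] at hjb ⊢
      exact hφ.bdInv s x (hb (by simpa using hjb))
    · simp only [if_true] at hjb
      have h0 : x ∈ simplexBd d := by
        have := hφ.bdInv (-s) _ hjb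
        rwa [← hφ.map_add, neg_add_cancel, hφ.map_zero] at this
      simpa using omega_closed_sub (bd_closed d) (fun t => hφ.bdInv t x h0) hy

theorem omega_trans {d : ℕ} {F : Euc d → Euc d} {φ : ℝ → Euc d → Euc d}
    (hφ : IsFlowOf d F φ) {x y z : Euc d}
    (hy : y ∈ omegaSet d φ x) (hz : z ∈ omegaSet d φ y) : z ∈ omegaSet d φ x := by
  rw [mem_omega_iff]
  intro ε hε T
  obtain ⟨t, -, ht⟩ := (mem_omega_iff φ y z).1 hz ε hε 0
  have hc : Continuous (φ t) := hφ.cont.comp (Continuous.prodMk_right t)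
  obtain ⟨u, hu, hu'⟩ := hy
  have h1 := ((hc.tendsto y).comp hu').eventually (isOpen_ball.mem_nhds (mem_ball.2 ht))
  obtain ⟨n, hn1, hn2⟩ := (h1.and (hu.eventually_ge_atTop (T - t))).exists
  refine ⟨t + u n, by linarith, ?_⟩
  rw [hφ.map_add]
  exact hn1

/-- if `x ∈ ∂Δ` or `ω(x) ⊆ Δ̊` then `ω(x) ⊆ R_ap`; and for every
`x ∈ Δ`, `ω(x) ∩ R_ap ≠ ∅`. -/
theorem stmt6 {d : ℕ} (hd : 1 ≤ d) (F : Euc d → Euc d) (hF : IsMeanField d F)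
    (φ : ℝ → Euc d → Euc d) (hφ : IsFlowOf d F φ)
    (x : Euc d) (hx : x ∈ simplexSet d) :
    ((x ∈ simplexBd d ∨ omegaSet d φ x ⊆ simplexInt d) → omegaSet d φ x ⊆ Rap d φ) ∧
    (omegaSet d φ x ∩ Rap d φ).Nonempty := by
  have key : (x ∈ simplexBd d ∨ omegaSet d φ x ⊆ simplexInt d) →
      omegaSet d φ x ⊆ Rap d φ := by
    rintro (h | h) y hy
    · exact omega_rap hφ hx hy fun _ => h
    · exact omega_rap hφ hx hy fun hb => absurd (h hy) hb.2
  refine ⟨key, ?_⟩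
  by_cases h : omegaSet d φ x ⊆ simplexInt d
  · obtain ⟨y, hy⟩ := omega_nonempty hφ hx
    exact ⟨y, hy, key (Or.inr h) hy⟩
  · obtain ⟨y, hy, hyi⟩ := not_subset.1 h
    have hyS := omega_closed_sub (simplex_closed d) (fun t => hφ.inv t x hx) hy
    obtain ⟨z, hz⟩ := omega_nonempty hφ hyS
    exact ⟨z, omega_trans hφ hy hz, omega_rap hφ hyS hz fun _ => ⟨hyS, hyi⟩⟩

end
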